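/- arXiv:0711.2749 — 3 statements merged into one kernel-verified Lean document; each statement's English description precedes it below -/
import Mathlib

section
/- For every odd integer n ≥ 3, there exists a position P on the board Rhombus(n) from which a super-sweep of length (3n+1)(n−1)/4 is legal. -/
/-- The six jump directions on the triangular lattice (oblique coordinates). -/
def Dirs : Finset (ℤ × ℤ) := {(1,0), (-1,0), (0,1), (0,-1), (1,1), (-1,-1)}

/-- The rhombus board of side `n`: `{0,…,n−1} × {0,…,n−1}`. -/
noncomputable def Rhombus (n : ℕ) : Finset (ℤ × ℤ) :=
  Finset.Icc (0 : ℤ) ((n : ℤ) - 1) ×ˢ Finset.Icc (0 : ℤ) ((n : ℤ) - 1)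

/-- A jump in position `P` on board `B`: peg at `p`, direction `d ∈ Dirs`,
peg at `p+d`, empty board hole at `p+2d`. -/
def JumpOK (B P : Finset (ℤ × ℤ)) (p d : ℤ × ℤ) : Prop :=
  d ∈ Dirs ∧ p ∈ P ∧ p + d ∈ P ∧ p + d + d ∈ B ∧ p + d + d ∉ P

/-- The position resulting from the jump `(p, d)` in position `P`. -/
def jumpResult (P : Finset (ℤ × ℤ)) (p d : ℤ × ℤ) : Finset (ℤ × ℤ) :=
  (P \ {p, p + d}) ∪ {p + d + d}

/-- `SweepFrom B P s ds e Q`: starting in position `P`, the peg at `s` makes the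
consecutive jumps with directions `ds` (each jump starting where the previous landed),
ending at hole `e` and producing position `Q`.  A move is such a sweep with `ds ≠ []`;
its length (number of pegs captured) is `ds.length`. -/
inductive SweepFrom (B : Finset (ℤ × ℤ)) :
    Finset (ℤ × ℤ) → ℤ × ℤ → List (ℤ × ℤ) → ℤ × ℤ → Finset (ℤ × ℤ) → Prop
  | nil (P : Finset (ℤ × ℤ)) (s : ℤ × ℤ) : SweepFrom B P s [] s P
  | cons {P : Finset (ℤ × ℤ)} {s d e : ℤ × ℤ} {ds : List (ℤ × ℤ)} {Q : Finset (ℤ × ℤ)} :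
      JumpOK B P s d → SweepFrom B (jumpResult P s d) (s + d + d) ds e Q →
      SweepFrom B P s (d :: ds) e Q

/-- A move is recorded as a pair (starting hole, nonempty list of jump directions).
`PlayMove B P m Q` says the move `m` is legal in position `P` and produces `Q`. -/
def PlayMove (B P : Finset (ℤ × ℤ)) (m : (ℤ × ℤ) × List (ℤ × ℤ))
    (Q : Finset (ℤ × ℤ)) : Prop :=
  m.2 ≠ [] ∧ ∃ e, SweepFrom B P m.1 m.2 e Q

/-- `Plays B P ms Q`: the finite sequence of moves `ms` leads from position `P`
to position `Q` on board `B`. -/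
inductive Plays (B : Finset (ℤ × ℤ)) :
    Finset (ℤ × ℤ) → List ((ℤ × ℤ) × List (ℤ × ℤ)) → Finset (ℤ × ℤ) → Prop
  | nil (P : Finset (ℤ × ℤ)) : Plays B P [] P
  | cons {P Q R : Finset (ℤ × ℤ)} {m : (ℤ × ℤ) × List (ℤ × ℤ)}
      {ms : List ((ℤ × ℤ) × List (ℤ × ℤ))} :
      PlayMove B P m Q → Plays B Q ms R → Plays B P (m :: ms) R

/-- The list of all holes touched by a sweep starting at `s` with directions `ds`:
every starting hole, every jumped-over hole and every landing hole. -/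
def sweepHoles (s : ℤ × ℤ) : List (ℤ × ℤ) → List (ℤ × ℤ)
  | [] => [s]
  | d :: ds => s :: (s + d) :: sweepHoles (s + d + d) ds

/-- The hole where a sweep starting at `s` with directions `ds` ends. -/
def sweepEnd (s : ℤ × ℤ) : List (ℤ × ℤ) → ℤ × ℤ
  | [] => s
  | d :: ds => sweepEnd (s + d + d) ds

/-- A single jump as a step relation between positions on board `B`. -/
def JumpStep (B P Q : Finset (ℤ × ℤ)) : Prop :=
  ∃ p d, JumpOK B P p d ∧ Q = jumpResult P p d

/-- The holes jumped over by a sweep starting at `s` with directions `ds`. -/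
def jumpedHoles (s : ℤ × ℤ) : List (ℤ × ℤ) → List (ℤ × ℤ)
  | [] => []
  | d :: ds => (s + d) :: jumpedHoles (s + d + d) ds

/-- A chain of jumps `ds` leading from `s` to `e` inside the board `B`, regardless of pegs. -/
inductive Route (B : Finset (ℤ × ℤ)) : ℤ × ℤ → List (ℤ × ℤ) → ℤ × ℤ → Prop
  | nil {s : ℤ × ℤ} : s ∈ B → Route B s [] s
  | cons {s d e : ℤ × ℤ} {ds : List (ℤ × ℤ)} : d ∈ Dirs → s ∈ B → s + d ∈ B →
      Route B (s + d + d) ds e → Route B s (d :: ds) e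

lemma mem_Rhombus {n : ℕ} {x : ℤ × ℤ} :
    x ∈ Rhombus n ↔ (0 ≤ x.1 ∧ x.1 < n) ∧ 0 ≤ x.2 ∧ x.2 < n := by
  simp only [Rhombus, Finset.mem_product, Finset.mem_Icc]
  omega

/-- A hole both of whose coordinates are even. -/
def EvenHole (x : ℤ × ℤ) : Prop := x.1 % 2 = 0 ∧ x.2 % 2 = 0

instance : DecidablePred EvenHole := fun _ => inferInstanceAs (Decidable (_ ∧ _))

lemma EvenHole.add_dir_add_dir {s : ℤ × ℤ} (hs : EvenHole s) (d : ℤ × ℤ) :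
    EvenHole (s + d + d) := by
  simp only [EvenHole, Prod.fst_add, Prod.snd_add] at *
  omega

lemma EvenHole.not_add_dir {s d : ℤ × ℤ} (hs : EvenHole s) (hd : d ∈ Dirs) :
    ¬ EvenHole (s + d) := by
  simp only [Dirs, Finset.mem_insert, Finset.mem_singleton] at hd
  simp only [EvenHole, Prod.fst_add, Prod.snd_add] at *
  rcases hd with rfl | rfl | rfl | rfl | rfl | rfl <;> dsimp only <;> omega

namespace Route

variable {B C : Finset (ℤ × ℤ)} {s e f : ℤ × ℤ} {ds es : List (ℤ × ℤ)}

lemma start_mem (h : Route B s ds e) : s ∈ B := by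
  cases h <;> assumption

lemma mono (hBC : B ⊆ C) (h : Route B s ds e) : Route C s ds e := by
  induction h with
  | nil hs => exact .nil (hBC hs)
  | cons hd hs hm _ ih => exact .cons hd (hBC hs) (hBC hm) ih

lemma append (h : Route B s ds e) (h' : Route B e es f) : Route B s (ds ++ es) f := by
  induction h with
  | nil _ => exact h'
  | cons hd hs hm _ ih => exact .cons hd hs hm (ih h')

lemma jumpedHoles_append (h : Route B s ds e) (es : List (ℤ × ℤ)) :
    jumpedHoles s (ds ++ es) = jumpedHoles s ds ++ jumpedHoles e es := by
  induction h with
  | nil _ => rfl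
  | cons _ _ _ _ ih => simp only [List.cons_append, jumpedHoles, ih]

lemma jumpedHoles_subset (h : Route B s ds e) {x : ℤ × ℤ} (hx : x ∈ jumpedHoles s ds) :
    x ∈ B := by
  induction h with
  | nil _ => simp [jumpedHoles] at hx
  | cons _ _ hm _ ih =>
    rcases List.mem_cons.1 hx with rfl | hx
    · exact hm
    · exact ih hx

lemma not_evenHole_of_mem_jumpedHoles (h : Route B s ds e) (hs : EvenHole s) {x : ℤ × ℤ}
    (hx : x ∈ jumpedHoles s ds) : ¬ EvenHole x := by
  induction h with
  | nil _ => simp [jumpedHoles] at hx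
  | @cons s d _ _ hd _ _ _ ih =>
    rcases List.mem_cons.1 hx with rfl | hx
    · exact hs.not_add_dir hd
    · exact ih (hs.add_dir_add_dir d) hx

lemma swap {n : ℕ} (h : Route (Rhombus n) s ds e) :
    Route (Rhombus n) s.swap (ds.map Prod.swap) e.swap := by
  induction h with
  | nil hs => exact .nil (by rw [mem_Rhombus] at *; exact hs.symm)
  | @cons s d _ _ hd hs hm _ ih =>
    refine .cons ?_ (by rw [mem_Rhombus] at *; exact hs.symm)
      (by rw [mem_Rhombus] at *; exact hm.symm) ih
    simp only [Dirs, Finset.mem_insert, Finset.mem_singleton] at hd ⊢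
    rcases hd with rfl | rfl | rfl | rfl | rfl | rfl <;> decide

/-- A route through even holes becomes a legal sweep when every jumped-over hole carries a peg,
no hole is jumped over twice, and no even hole but the start carries a peg. -/
lemma exists_sweepFrom (h : Route B s ds e) (hs : EvenHole s) (hnd : (jumpedHoles s ds).Nodup)
    {P : Finset (ℤ × ℤ)} (hsP : s ∈ P) (hP : ∀ x ∈ P, EvenHole x → x = s)
    (hj : ∀ x ∈ jumpedHoles s ds, x ∈ P) : ∃ Q, SweepFrom B P s ds e Q := by
  induction h generalizing P with
  | nil _ => exact ⟨P, .nil P _⟩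
  | @cons s d e ds hd _ _ hr ih =>
    have hne : s + d + d ≠ s := by
      intro h0
      have h1 := congrArg Prod.fst h0
      have h2 := congrArg Prod.snd h0
      simp only [Prod.fst_add, Prod.snd_add] at h1 h2
      have hd0 : d = 0 := Prod.ext (by simp; omega) (by simp; omega)
      exact absurd (hd0 ▸ hd) (by decide)
    have heven := hs.add_dir_add_dir d
    obtain ⟨hnotMem, hnd⟩ := List.nodup_cons.1 hnd
    obtain ⟨Q, hQ⟩ := ih heven hnd (P := jumpResult P s d) (by simp [jumpResult])
      (by
        intro x hx hxe
        simp only [jumpResult, Finset.mem_union, Finset.mem_sdiff, Finset.mem_insert,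
          Finset.mem_singleton] at hx
        rcases hx with ⟨hx, hx'⟩ | hx
        · exact absurd (Or.inl (hP x hx hxe)) hx'
        · exact hx)
      (by
        intro x hx
        have hxP := hj x (List.mem_cons_of_mem _ hx)
        have hxs : x ≠ s := by
          rintro rfl
          exact hr.not_evenHole_of_mem_jumpedHoles heven hx hs
        have hxd : x ≠ s + d := by
          rintro rfl
          exact hnotMem hx
        simp only [jumpResult, Finset.mem_union, Finset.mem_sdiff, Finset.mem_insert,
          Finset.mem_singleton]
        exact Or.inl ⟨hxP, not_or.2 ⟨hxs, hxd⟩⟩)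
    exact ⟨Q, .cons ⟨hd, hsP, hj _ List.mem_cons_self, hr.start_mem,
      fun hmem => hne (hP _ hmem heven)⟩ hQ⟩

end Route

lemma length_jumpedHoles (s : ℤ × ℤ) (ds : List (ℤ × ℤ)) :
    (jumpedHoles s ds).length = ds.length := by
  induction ds generalizing s with
  | nil => rfl
  | cons d ds ih => simp [jumpedHoles, ih]

lemma start_mem_sweepHoles (s : ℤ × ℤ) (ds : List (ℤ × ℤ)) : s ∈ sweepHoles s ds := by
  cases ds <;> simp [sweepHoles]

lemma jumpedHoles_subset_sweepHoles {s x : ℤ × ℤ} {ds : List (ℤ × ℤ)}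
    (hx : x ∈ jumpedHoles s ds) : x ∈ sweepHoles s ds := by
  induction ds generalizing s with
  | nil => simp [jumpedHoles] at hx
  | cons d ds ih =>
    rcases List.mem_cons.1 hx with rfl | hx
    · simp [sweepHoles]
    · simp [sweepHoles, ih hx]

/-- A hole with odd first and even second coordinate is only jumped over horizontally, so that
both its horizontal neighbours are visited. -/
lemma Route.neighbours_mem_sweepHoles {B : Finset (ℤ × ℤ)} {s e : ℤ × ℤ} {ds : List (ℤ × ℤ)}
    (h : Route B s ds e) (hs : EvenHole s) {x y : ℤ} (hx : x % 2 = 1) (hy : y % 2 = 0)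
    (hj : (x, y) ∈ jumpedHoles s ds) :
    (x - 1, y) ∈ sweepHoles s ds ∧ (x + 1, y) ∈ sweepHoles s ds := by
  induction h with
  | nil _ => simp [jumpedHoles] at hj
  | @cons s d e ds hd _ _ _ ih =>
    rcases List.mem_cons.1 hj with hj | hj
    · have hstart : s ∈ sweepHoles s (d :: ds) := start_mem_sweepHoles _ _
      have hland : s + d + d ∈ sweepHoles s (d :: ds) := by
        simp [sweepHoles, start_mem_sweepHoles]
      obtain ⟨a, b⟩ := s
      simp only [EvenHole] at hs
      simp only [Dirs, Finset.mem_insert, Finset.mem_singleton] at hd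
      rcases hd with rfl | rfl | rfl | rfl | rfl | rfl <;>
        simp only [Prod.mk_add_mk, Prod.mk.injEq] at hj hland <;> try omega
      · exact ⟨by convert hstart using 2 <;> omega, by convert hland using 2 <;> omega⟩
      · exact ⟨by convert hland using 2 <;> omega, by convert hstart using 2 <;> omega⟩
    · have := ih (hs.add_dir_add_dir d) hj
      simp [sweepHoles, this]

lemma swap_mem_jumpedHoles {s x : ℤ × ℤ} {ds : List (ℤ × ℤ)} (hx : x ∈ jumpedHoles s ds) :
    x.swap ∈ jumpedHoles s.swap (ds.map Prod.swap) := by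
  induction ds generalizing s with
  | nil => simp [jumpedHoles] at hx
  | cons d ds ih =>
    rcases List.mem_cons.1 hx with rfl | hx
    · exact List.mem_cons_self
    · exact List.mem_cons_of_mem _ (ih hx)

/-- `k` repetitions of a diagonal jump backwards followed by a horizontal jump forwards. -/
def zigzag : ℕ → List (ℤ × ℤ)
  | 0 => []
  | k + 1 => (-1, -1) :: (1, 0) :: zigzag k

lemma length_zigzag (k : ℕ) : (zigzag k).length = 2 * k := by
  induction k with
  | zero => rfl
  | succ k ih => simp [zigzag, ih]; omega

lemma route_zigzag {n : ℕ} {a : ℤ} (ha : 2 ≤ a) (han : a < n) (k : ℕ) {b c : ℤ} (hb : 0 ≤ b)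
    (hc : c = b + 2 * k) (hcn : c < n) : Route (Rhombus n) (a, c) (zigzag k) (a, b) := by
  induction k generalizing c with
  | zero =>
    obtain rfl : c = b := by simpa using hc
    exact .nil (by rw [mem_Rhombus]; dsimp only; omega)
  | succ k ih =>
    push_cast at hc
    refine .cons (by decide) ?_ ?_ (.cons (by decide) ?_ ?_ ?_)
    · rw [mem_Rhombus]; dsimp only; omega
    · rw [mem_Rhombus]; simp only [Prod.mk_add_mk]; omega
    · rw [mem_Rhombus]; simp only [Prod.mk_add_mk]; omega
    · rw [mem_Rhombus]; simp only [Prod.mk_add_mk]; omega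
    · convert ih (c := c - 2) (by omega) (by omega) using 1
      ext <;> simp
      omega

lemma mem_jumpedHoles_zigzag (k : ℕ) {a x y c : ℤ} (hx : x + 1 = a) (hy : c - 2 * k ≤ y)
    (hyc : y < c) : (x, y) ∈ jumpedHoles (a, c) (zigzag k) := by
  induction k generalizing c with
  | zero => push_cast at hy; omega
  | succ k ih =>
    push_cast at hy
    simp only [zigzag, jumpedHoles, List.mem_cons, Prod.mk_add_mk, Prod.mk.injEq]
    by_cases h1 : y = c - 1
    · left; omega
    by_cases h2 : y = c - 2
    · right; left; omega
    right; right
    convert ih (c := c - 2) (by omega) (by omega) using 2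
    ext <;> simp
    omega

lemma route_vertical {n : ℕ} {a : ℤ} (ha : 0 ≤ a) (han : a < n) (k : ℕ) {b c : ℤ} (hb : 0 ≤ b)
    (hc : c = b + 2 * k) (hcn : c < n) :
    Route (Rhombus n) (a, b) (List.replicate k (0, 1)) (a, c) := by
  induction k generalizing b with
  | zero =>
    obtain rfl : c = b := by simpa using hc
    exact .nil (by rw [mem_Rhombus]; dsimp only; omega)
  | succ k ih =>
    push_cast at hc
    refine .cons (by decide) ?_ ?_ ?_
    · rw [mem_Rhombus]; dsimp only; omega
    · rw [mem_Rhombus]; simp only [Prod.mk_add_mk]; omega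
    · convert ih (b := b + 2) (by omega) (by omega) using 1
      ext <;> simp
      omega

lemma mem_jumpedHoles_vertical (k : ℕ) {a b y : ℤ} (hy : b ≤ y) (hyk : y < b + 2 * k)
    (hodd : (y - b) % 2 = 1) :
    (a, y) ∈ jumpedHoles (a, b) (List.replicate k (0, 1)) := by
  induction k generalizing b with
  | zero => push_cast at hyk; omega
  | succ k ih =>
    push_cast at hyk
    simp only [List.replicate_succ, jumpedHoles, List.mem_cons, Prod.mk_add_mk, Prod.mk.injEq]
    by_cases h1 : y = b + 1
    · left; omega
    right
    convert ih (b := b + 2) (by omega) (by omega) (by omega) using 2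
    ext <;> simp
    omega

/-- The route from `(2m, 2m)` to `(2m+2, 2m+2)` that zigzags down between the columns `2m` and
`2m+2` and then climbs the column `2m+2`. -/
def columnTour (m : ℕ) : List (ℤ × ℤ) :=
  (1, 0) :: (zigzag m ++ List.replicate (m + 1) (0, 1))

lemma length_columnTour (m : ℕ) : (columnTour m).length = 3 * m + 2 := by
  simp [columnTour, length_zigzag]; omega

lemma route_columnTour (m : ℕ) :
    Route (Rhombus (2 * m + 3)) (2 * m, 2 * m) (columnTour m) (2 * m + 2, 2 * m + 2) := by
  refine .cons (by decide) ?_ ?_ ?_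
  · rw [mem_Rhombus]; push_cast; omega
  · rw [mem_Rhombus]; push_cast; simp only [Prod.mk_add_mk]; omega
  · have h1 : Route (Rhombus (2 * m + 3)) (2 * m + 2, 2 * m) (zigzag m) (2 * m + 2, 0) :=
      route_zigzag (by omega) (by push_cast; omega) m le_rfl (by omega) (by push_cast; omega)
    have h2 := route_vertical (n := 2 * m + 3) (a := 2 * m + 2) (by omega) (by push_cast; omega)
      (m + 1) (b := 0) (c := 2 * m + 2) le_rfl (by push_cast; omega) (by push_cast; omega)
    convert h1.append h2 using 1
    ext <;> simp
    omega

lemma mem_jumpedHoles_columnTour {m : ℕ} {x y : ℤ} (hy : 0 ≤ y)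
    (h : x = 2 * m + 1 ∧ y ≤ 2 * m ∨ x = 2 * m + 2 ∧ y ≤ 2 * m + 1 ∧ y % 2 = 1) :
    (x, y) ∈ jumpedHoles (2 * m, 2 * m) (columnTour m) := by
  have h1 : Route (Rhombus (2 * m + 3)) (2 * m + 2, 2 * m) (zigzag m) (2 * m + 2, 0) :=
    route_zigzag (by omega) (by push_cast; omega) m le_rfl (by omega) (by push_cast; omega)
  have hstart : ((2 * (m : ℤ), 2 * (m : ℤ)) + (1, 0) + (1, 0)) =
      (2 * (m : ℤ) + 2, 2 * (m : ℤ)) := by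
    simp [add_assoc]
  simp only [columnTour, jumpedHoles, hstart, h1.jumpedHoles_append, List.mem_cons,
    List.mem_append]
  rcases h with ⟨rfl, hy'⟩ | ⟨rfl, hy', hodd⟩
  · rcases hy'.eq_or_lt with rfl | hlt
    · left; simp
    · right; left
      exact mem_jumpedHoles_zigzag m (by omega) (by omega) hlt
  · right; right
    exact mem_jumpedHoles_vertical _ hy (by push_cast; omega) (by omega)

/-- A route from `(0, 0)` to `(2m, 2m)` using every jump between even holes exactly once. -/
def eulerTour : ℕ → List (ℤ × ℤ)
  | 0 => []
  | m + 1 => eulerTour m ++ (columnTour m ++ (-1, -1) :: (columnTour m).map Prod.swap)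

lemma length_eulerTour (m : ℕ) : (eulerTour m).length = m * (3 * m + 2) := by
  induction m with
  | zero => rfl
  | succ m ih => simp [eulerTour, ih, length_columnTour]; ring

lemma Rhombus_mono {k n : ℕ} (h : k ≤ n) : Rhombus k ⊆ Rhombus n := by
  intro x hx
  rw [mem_Rhombus] at *
  omega

lemma diagonal_jump_back (a : ℤ) :
    ((a + 2, a + 2) + (-1, -1) + (-1, -1) : ℤ × ℤ) = (a, a) := by
  ext <;> simp <;> omega

lemma route_eulerTour (m : ℕ) :
    Route (Rhombus (2 * m + 1)) (0, 0) (eulerTour m) (2 * m, 2 * m) := by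
  induction m with
  | zero => exact .nil (by simp [mem_Rhombus])
  | succ m ih =>
    have hcol := route_columnTour m
    have hrow : Route (Rhombus (2 * m + 3)) (2 * m + 2, 2 * m + 2)
        ((-1, -1) :: (columnTour m).map Prod.swap) (2 * m + 2, 2 * m + 2) := by
      refine .cons (by decide) ?_ ?_ (diagonal_jump_back (2 * m) ▸ hcol.swap)
      · rw [mem_Rhombus]; push_cast; omega
      · rw [mem_Rhombus]; push_cast; simp only [Prod.mk_add_mk]; omega
    have hend : 2 * ((m + 1 : ℕ) : ℤ) = 2 * m + 2 := by push_cast; ring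
    rw [hend]
    exact (ih.mono (Rhombus_mono (by omega))).append (hcol.append hrow)

lemma mem_jumpedHoles_eulerTour {m : ℕ} {x : ℤ × ℤ} (hx : x ∈ Rhombus (2 * m + 1))
    (hodd : ¬ EvenHole x) : x ∈ jumpedHoles (0, 0) (eulerTour m) := by
  induction m with
  | zero =>
    rw [mem_Rhombus] at hx
    simp only [EvenHole] at hodd
    push_cast at hx
    omega
  | succ m ih =>
    simp only [eulerTour, (route_eulerTour m).jumpedHoles_append,
      (route_columnTour m).jumpedHoles_append, jumpedHoles, diagonal_jump_back,
      List.mem_append, List.mem_cons]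
    rw [mem_Rhombus] at ih hx
    obtain ⟨x, y⟩ := x
    simp only [EvenHole] at hodd
    push_cast at ih hx
    by_cases hold : x < 2 * m + 1 ∧ y < 2 * m + 1
    · exact Or.inl (ih (by omega))
    by_cases hcol : x = 2 * m + 1 ∧ y ≤ 2 * m ∨ x = 2 * m + 2 ∧ y ≤ 2 * m + 1 ∧ y % 2 = 1
    · exact Or.inr (Or.inl (mem_jumpedHoles_columnTour (by omega) hcol))
    by_cases hdiag : x = 2 * m + 1 ∧ y = 2 * m + 1
    · right; right; left
      simp only [Prod.mk_add_mk, Prod.mk.injEq]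
      omega
    · right; right; right
      exact swap_mem_jumpedHoles (x := (y, x)) (s := (2 * m, 2 * m))
        (mem_jumpedHoles_columnTour (by omega) (by omega))

lemma card_filter_not_evenHole (m : ℕ) :
    ((Rhombus (2 * m + 1)).filter fun x => ¬ EvenHole x).card = m * (3 * m + 2) := by
  have heven : ((Rhombus (2 * m + 1)).filter EvenHole).card = (m + 1) * (m + 1) := by
    rw [← Finset.card_range (m + 1), ← Finset.card_product]
    symm
    refine Finset.card_nbij' (fun p => (2 * (p.1 : ℤ), 2 * (p.2 : ℤ)))
      (fun x => (x.1.toNat / 2, x.2.toNat / 2)) ?_ ?_ ?_ ?_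
    · intro p hp
      simp only [Finset.coe_product, Set.mem_prod, Finset.mem_coe, Finset.mem_range,
        Finset.mem_filter, mem_Rhombus, EvenHole] at *
      push_cast
      omega
    · intro x hx
      simp only [Finset.coe_product, Set.mem_prod, Finset.mem_coe, Finset.mem_range,
        Finset.mem_filter, mem_Rhombus, EvenHole] at *
      push_cast at hx
      omega
    · intro p _
      ext <;> simp <;> omega
    · intro x hx
      simp only [Finset.mem_coe, Finset.mem_filter, mem_Rhombus, EvenHole] at hx
      ext <;> simp <;> omega
  have hcard : (Rhombus (2 * m + 1)).card = (2 * m + 1) * (2 * m + 1) := by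
    simp [Rhombus]
    norm_cast
  have hsum := Finset.card_filter_add_card_filter_not (s := Rhombus (2 * m + 1)) EvenHole
  rw [heven, hcard] at hsum
  nlinarith

lemma nodup_jumpedHoles_eulerTour (m : ℕ) : (jumpedHoles (0, 0) (eulerTour m)).Nodup := by
  rw [← Multiset.coe_nodup, ← Multiset.toFinset_card_eq_card_iff_nodup]
  apply le_antisymm (Multiset.toFinset_card_le _)
  rw [Multiset.coe_card, length_jumpedHoles, length_eulerTour, ← card_filter_not_evenHole]
  refine Finset.card_le_card fun x hx => ?_
  rw [Finset.mem_filter] at hx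
  simpa using mem_jumpedHoles_eulerTour hx.1 hx.2

lemma mem_sweepHoles_eulerTour {m : ℕ} (hm : 1 ≤ m) {x : ℤ × ℤ}
    (hx : x ∈ Rhombus (2 * m + 1)) : x ∈ sweepHoles (0, 0) (eulerTour m) := by
  by_cases heven : EvenHole x
  · have hneighbours : ∀ a b : ℤ, a % 2 = 1 → b % 2 = 0 → (a, b) ∈ Rhombus (2 * m + 1) →
        (a - 1, b) ∈ sweepHoles (0, 0) (eulerTour m) ∧
          (a + 1, b) ∈ sweepHoles (0, 0) (eulerTour m) := fun a b ha hb hab =>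
      (route_eulerTour m).neighbours_mem_sweepHoles (by decide) ha hb
        (mem_jumpedHoles_eulerTour hab (by simp only [EvenHole]; omega))
    obtain ⟨x, y⟩ := x
    simp only [mem_Rhombus] at hx hneighbours
    simp only [EvenHole] at heven
    push_cast at hx hneighbours
    by_cases h0 : x = 0
    · simpa using (hneighbours (x + 1) y (by omega) (by omega) (by omega)).1
    · simpa using (hneighbours (x - 1) y (by omega) (by omega) (by omega)).2
  · exact jumpedHoles_subset_sweepHoles (mem_jumpedHoles_eulerTour hx heven)

/-- For every odd `n ≥ 3`, there is a position on `Rhombus n` from which a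
super-sweep of length `(3*n+1)*(n-1)/4` is legal (a sweep touching every hole of the
board: every hole is a starting, jumped-over, or landing hole of some jump). -/
theorem rhombus_odd_supersweep (n : ℕ) (hn : 3 ≤ n) (hodd : Odd n) :
    ∃ P ⊆ Rhombus n,
      ∃ (s : ℤ × ℤ) (ds : List (ℤ × ℤ)) (e : ℤ × ℤ) (Q : Finset (ℤ × ℤ)),
        ds ≠ [] ∧ SweepFrom (Rhombus n) P s ds e Q ∧
        ds.length = (3 * n + 1) * (n - 1) / 4 ∧
        ∀ b ∈ Rhombus n, b ∈ sweepHoles s ds := by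
  obtain ⟨m, rfl⟩ := hodd
  have hm : 1 ≤ m := by omega
  have hroute := route_eulerTour m
  have hlen : (eulerTour m).length = (3 * (2 * m + 1) + 1) * (2 * m + 1 - 1) / 4 := by
    rw [length_eulerTour, Nat.add_sub_cancel]
    symm
    apply Nat.div_eq_of_eq_mul_right (by norm_num)
    ring
  have hstart : EvenHole (0, 0) := by decide
  obtain ⟨Q, hQ⟩ := hroute.exists_sweepFrom hstart (nodup_jumpedHoles_eulerTour m)
    (P := insert (0, 0) ((Rhombus (2 * m + 1)).filter fun x => ¬ EvenHole x))
    (Finset.mem_insert_self _ _)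
    (fun x hx hxe => (Finset.mem_insert.1 hx).resolve_right
      fun h => (Finset.mem_filter.1 h).2 hxe)
    (fun x hx => Finset.mem_insert_of_mem (Finset.mem_filter.2
      ⟨hroute.jumpedHoles_subset hx, hroute.not_evenHole_of_mem_jumpedHoles hstart hx⟩))
  refine ⟨_, Finset.insert_subset hroute.start_mem (Finset.filter_subset _ _), (0, 0),
    eulerTour m, _, Q, ?_, hQ, hlen, fun b hb => mem_sweepHoles_eulerTour hm hb⟩
  rw [← List.length_pos_iff, length_eulerTour]
  positivity
end

section
/- On the board Rhombus(6), the e4-complement problem (vacancy at e4 = (4,3), final peg at e4) has a solution whose second-to-last move is a sweep of length 16. -/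
instance (B P : Finset (ℤ × ℤ)) (p d : ℤ × ℤ) : Decidable (JumpOK B P p d) := by
  unfold JumpOK; infer_instance

/-- The position after the sweep from `s` along `ds`, or `none` if some jump is illegal. -/
def runSweep (B P : Finset (ℤ × ℤ)) (s : ℤ × ℤ) : List (ℤ × ℤ) → Option (Finset (ℤ × ℤ))
  | [] => some P
  | d :: ds => if JumpOK B P s d then runSweep B (jumpResult P s d) (s + d + d) ds else none

/-- The position after a sequence of moves, or `none` if some move is empty or illegal. -/
def runMoves (B P : Finset (ℤ × ℤ)) :
    List ((ℤ × ℤ) × List (ℤ × ℤ)) → Option (Finset (ℤ × ℤ))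
  | [] => some P
  | m :: ms => if m.2 = [] then none else (runSweep B P m.1 m.2).bind fun Q => runMoves B Q ms

theorem sweepFrom_of_runSweep_eq_some {B P Q : Finset (ℤ × ℤ)} {s : ℤ × ℤ} {ds : List (ℤ × ℤ)}
    (h : runSweep B P s ds = some Q) : SweepFrom B P s ds (sweepEnd s ds) Q := by
  induction ds generalizing P s with
  | nil =>
    cases h
    exact .nil _ _
  | cons d ds ih =>
    rw [runSweep] at h
    split_ifs at h with hd
    exact .cons hd (ih h)

theorem plays_of_runMoves_eq_some {B P Q : Finset (ℤ × ℤ)}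
    {ms : List ((ℤ × ℤ) × List (ℤ × ℤ))} (h : runMoves B P ms = some Q) : Plays B P ms Q := by
  induction ms generalizing P with
  | nil =>
    cases h
    exact .nil _
  | cons m ms ih =>
    rw [runMoves] at h
    split_ifs at h with hm
    obtain ⟨R, hR, hQ⟩ := Option.bind_eq_some_iff.mp h
    exact .cons ⟨hm, _, sweepFrom_of_runSweep_eq_some hR⟩ (ih hQ)

/-- On `Rhombus 6`, the e4-complement problem (e4 = (4,3)) has a solution
whose second-to-last move is a sweep of length 16. -/
theorem rhombus6_e4_complement_secondlast_16sweep :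
    ∃ (ms : List ((ℤ × ℤ) × List (ℤ × ℤ))) (m₁ m₂ : (ℤ × ℤ) × List (ℤ × ℤ)),
      Plays (Rhombus 6) ((Rhombus 6).erase ((4 : ℤ), (3 : ℤ))) (ms ++ [m₁, m₂])
        {((4 : ℤ), (3 : ℤ))} ∧
      m₁.2.length = 16 := by
  refine ⟨[
    ((2, 1), [(1, 1)]), ((3, 0), [(0, 1)]), ((3, 3), [(0, -1)]), ((5, 5), [(-1, -1)]),
    ((5, 2), [(-1, 0)]), ((5, 4), [(0, -1)]), ((2, 0), [(1, 1)]), ((2, 3), [(0, -1)]),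
    ((0, 3), [(1, 0)]), ((0, 5), [(0, -1)]), ((0, 2), [(0, 1)]), ((2, 5), [(-1, 0)]),
    ((0, 5), [(0, -1)]), ((3, 5), [(-1, -1)]), ((5, 0), [(-1, 0)]), ((5, 1), [(0, 1)]),
    ((5, 3), [(-1, -1)])],
    ((0, 0), [(1, 0), (1, 0), (0, 1), (-1, 0), (-1, 0), (0, 1), (1, 0), (1, 0),
      (0, -1), (-1, -1), (0, 1), (0, 1), (-1, -1), (0, -1), (1, 1), (1, 1)]),
    ((4, 5), [(0, -1)]), plays_of_runMoves_eq_some ?_, rfl⟩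
  decide +kernel
end

section
/- On the board Rhombus(6), the d3-complement problem (vacancy at d3 = (3,2), final peg at d3) has a solution whose third-to-last move is a sweep of length 16. -/
instance inst_s12 (B P : Finset (ℤ × ℤ)) (p d : ℤ × ℤ) : Decidable (JumpOK B P p d) :=
  inferInstanceAs (Decidable (_ ∧ _))

/-- The position produced by a sweep, or `none` if one of its jumps is illegal. -/
def sweepResult (B : Finset (ℤ × ℤ)) :
    Finset (ℤ × ℤ) → ℤ × ℤ → List (ℤ × ℤ) → Option (Finset (ℤ × ℤ))
  | P, _, [] => some P
  | P, s, d :: ds =>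
    if JumpOK B P s d then sweepResult B (jumpResult P s d) (s + d + d) ds else none

/-- The position produced by a sequence of moves, or `none` if one of them is illegal. -/
def playResult (B : Finset (ℤ × ℤ)) :
    Finset (ℤ × ℤ) → List ((ℤ × ℤ) × List (ℤ × ℤ)) → Option (Finset (ℤ × ℤ))
  | P, [] => some P
  | P, m :: ms =>
    if m.2 = [] then none
    else (sweepResult B P m.1 m.2).bind fun Q => playResult B Q ms

theorem sweepFrom_of_sweepResult_eq_some {B P Q : Finset (ℤ × ℤ)} {s : ℤ × ℤ}
    {ds : List (ℤ × ℤ)} (h : sweepResult B P s ds = some Q) :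
    SweepFrom B P s ds (sweepEnd s ds) Q := by
  induction ds generalizing P s with
  | nil =>
    obtain rfl : P = Q := by simpa [sweepResult] using h
    exact .nil P s
  | cons d ds ih =>
    by_cases hj : JumpOK B P s d
    · rw [sweepResult, if_pos hj] at h
      exact .cons hj (ih h)
    · simp [sweepResult, hj] at h

theorem plays_of_playResult_eq_some {B P Q : Finset (ℤ × ℤ)}
    {ms : List ((ℤ × ℤ) × List (ℤ × ℤ))} (h : playResult B P ms = some Q) :
    Plays B P ms Q := by
  induction ms generalizing P with
  | nil =>
    obtain rfl : P = Q := by simpa [playResult] using h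
    exact .nil P
  | cons m ms ih =>
    by_cases hm : m.2 = []
    · simp [playResult, hm] at h
    · rw [playResult, if_neg hm, Option.bind_eq_some_iff] at h
      obtain ⟨R, hR, h⟩ := h
      exact .cons ⟨hm, _, sweepFrom_of_sweepResult_eq_some hR⟩ (ih h)

/-- On `Rhombus 6`, the d3-complement problem (d3 = (3,2)) has a solution
whose third-to-last move is a sweep of length 16. -/
theorem rhombus6_d3_complement_thirdlast_16sweep :
    ∃ (ms : List ((ℤ × ℤ) × List (ℤ × ℤ))) (m₁ m₂ m₃ : (ℤ × ℤ) × List (ℤ × ℤ)),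
      Plays (Rhombus 6) ((Rhombus 6).erase ((3 : ℤ), (2 : ℤ))) (ms ++ [m₁, m₂, m₃])
        {((3 : ℤ), (2 : ℤ))} ∧
      m₁.2.length = 16 := by
  refine ⟨[((3, 4), [(0, -1)]), ((5, 5), [(-1, -1)]), ((1, 2), [(1, 1)]),
      ((3, 2), [(-1, 0)]), ((3, 0), [(0, 1)]), ((5, 3), [(-1, -1)]),
      ((5, 0), [(-1, 0)]), ((5, 2), [(0, -1)]), ((0, 3), [(1, 0)]),
      ((0, 5), [(0, -1)]), ((0, 2), [(0, 1)]), ((2, 0), [(1, 0)]),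
      ((2, 5), [(-1, 0)]), ((0, 5), [(0, -1)]), ((3, 5), [(-1, -1)]),
      ((5, 0), [(-1, 0)])],
    ((0, 0), [(1, 0), (1, 0), (0, 1), (-1, 0), (-1, 0), (0, 1), (1, 0), (1, 0),
      (0, -1), (-1, -1), (0, 1), (0, 1), (-1, -1), (0, -1), (1, 1), (1, 1)]),
    ((4, 5), [(0, -1)]), ((5, 4), [(-1, -1)]), plays_of_playResult_eq_some ?_, rfl⟩
  decide +kernel
end
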